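/- arXiv:2302.12754 — 3 statements merged into one kernel-verified Lean document; each statement's English description precedes it below -/
import Mathlib

section
/- Let X be a complete separable metric space and Y a complete metric space. Let μ_n (n ∈ ℕ) and μ be Radon probability measures on X with ‖μ_n − μ‖ → 0 in the total variation norm, and let π_n and π be Radon probability measures on X × Y whose projections onto X equal μ_n and μ respectively, such that π_n converges weakly to π. Let B_n, B ⊂ X be Borel sets with μ(B_n △ B) → 0. Then the measures 1_{B_n×Y}·π_n converge weakly to 1_{B×Y}·π; in particular, the projections onto Y of 1_{B_n×Y}·π_n converge weakly to the projection onto Y of 1_{B×Y}·π. -/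
open MeasureTheory Filter Topology

noncomputable section

/-- The total variation distance between two measures:
`sup_B |μ(B) − ν(B)|` over measurable sets `B` (computed in `ℝ≥0∞` via truncated
subtraction in both directions). -/
def tvDist {X : Type*} [MeasurableSpace X] (μ ν : Measure X) : ENNReal :=
  ⨆ (s : Set X) (_ : MeasurableSet s), ((μ s - ν s) + (ν s - μ s))

theorem aux_ineq {X Y : Type*} [MetricSpace X] [TopologicalSpace.SeparableSpace X]
    [MetricSpace Y]
    [MeasurableSpace X] [BorelSpace X] [MeasurableSpace Y] [BorelSpace Y]
    (ν : Measure (X × Y)) [IsProbabilityMeasure ν]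
    (f : BoundedContinuousFunction (X × Y) ℝ) (g : BoundedContinuousFunction X ℝ)
    (B D : Set X) (hB : MeasurableSet B) (hD : MeasurableSet D)
    (h : ∀ x, |B.indicator (fun _ => (1 : ℝ)) x - g x| ≤ D.indicator (fun _ => (1 : ℝ)) x) :
    |(∫ p, f p ∂(ν.restrict (B ×ˢ Set.univ))) - ∫ p, f p * g p.1 ∂ν|
      ≤ ‖f‖ * (ν.map Prod.fst).real D := by
  haveI : SecondCountableTopology X := UniformSpace.secondCountable_of_separable X
  have hBm : MeasurableSet (B ×ˢ (Set.univ : Set Y)) := hB.prod MeasurableSet.univ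
  have hDm : MeasurableSet (D ×ˢ (Set.univ : Set Y)) := hD.prod MeasurableSet.univ
  have hf : Integrable (fun p => f p) ν := f.integrable ν
  have hfg : Integrable (fun p => f p * g p.1) ν :=
    (f * g.compContinuous ⟨Prod.fst, continuous_fst⟩).integrable ν
  have hDe : (ν.map Prod.fst).real D = ν.real (D ×ˢ (Set.univ : Set Y)) := by
    rw [map_measureReal_apply measurable_fst hD, Set.prod_univ]
  rw [← integral_indicator hBm, ← integral_sub (hf.indicator hBm) hfg, hDe, ← Real.norm_eq_abs]
  calc _ ≤ ∫ p, (D ×ˢ (Set.univ : Set Y)).indicator (fun _ => ‖f‖) p ∂ν := by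
        apply norm_integral_le_of_norm_le ((integrable_const _).indicator hDm)
        refine Eventually.of_forall fun p => ?_
        have h1 := h p.1
        have h2 := f.norm_coe_le_norm p
        have e1 : (B ×ˢ (Set.univ : Set Y)).indicator (fun p => f p) p - f p * g p.1
            = f p * (B.indicator (fun _ => (1 : ℝ)) p.1 - g p.1) := by
          by_cases hp : p.1 ∈ B <;> simp [Set.indicator, hp] <;> ring
        have e2 : (D ×ˢ (Set.univ : Set Y)).indicator (fun _ => ‖f‖) p
            = ‖f‖ * D.indicator (fun _ => (1 : ℝ)) p.1 := by
          by_cases hp : p.1 ∈ D <;> simp [Set.indicator, hp]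
        rw [e1, e2, norm_mul]
        exact mul_le_mul h2 h1 (abs_nonneg _) (norm_nonneg _)
    _ = _ := by
        rw [integral_indicator hDm]; simp [mul_comm]

theorem aux_fun {X : Type*} [MetricSpace X] [MeasurableSpace X] [BorelSpace X]
    (μ : Measure X) [IsProbabilityMeasure μ] (B : Set X) (hB : MeasurableSet B)
    (ε : ENNReal) (hε : ε ≠ 0) :
    ∃ (g : BoundedContinuousFunction X ℝ) (D : Set X), MeasurableSet D ∧ μ D ≤ ε ∧
      (∀ x, g x ∈ Set.Icc (0 : ℝ) 1) ∧ ∀ x, |B.indicator (fun _ => (1 : ℝ)) x - g x| ≤ D.indicator (fun _ => (1 : ℝ)) x := by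
  have hε2 : ε / 2 ≠ 0 := by simpa using hε
  obtain ⟨K, hKB, hK, hKm⟩ := hB.exists_isClosed_diff_lt (measure_ne_top μ B) hε2
  obtain ⟨U, hBU, hU, -, hUm⟩ := hB.exists_isOpen_diff_lt (measure_ne_top μ B) hε2
  obtain ⟨g, hg0, hg1, hg⟩ := exists_bounded_zero_one_of_closed hU.isClosed_compl hK
    (Set.disjoint_left.2 fun x hx hx' => hx (hBU (hKB hx')))
  refine ⟨g, (U \ B) ∪ (B \ K), (hU.measurableSet.diff hB).union (hB.diff hK.measurableSet),
    ?_, hg, fun x => ?_⟩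
  · calc _ ≤ μ (U \ B) + μ (B \ K) := measure_union_le _ _
      _ ≤ ε / 2 + ε / 2 := add_le_add hUm.le hKm.le
      _ = ε := ENNReal.add_halves ε
  · have := hg x
    by_cases hxB : x ∈ B
    · by_cases hxK : x ∈ K
      · have := hg1 hxK
        simp [Set.indicator, hxB, hxK, this]
      · rw [Set.indicator_of_mem (s := (U \ B) ∪ (B \ K)) (Or.inr ⟨hxB, hxK⟩)]
        simp [Set.indicator, hxB, abs_le]; constructor <;> linarith [this.1, this.2]
    · by_cases hxU : x ∈ U
      · rw [Set.indicator_of_mem (s := (U \ B) ∪ (B \ K)) (Or.inl ⟨hxU, hxB⟩)]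
        simp [Set.indicator, hxB, abs_le]; constructor <;> linarith [this.1, this.2]
      · have := hg0 hxU
        simp [Set.indicator, hxB, hxU, this]

/-- Let `X` be a complete separable metric space, `Y` a complete metric
space, `μ n → μ` Radon probability measures on `X` converging in total variation, and
`π n`, `π` Radon probability measures on `X × Y` with `X`-projections `μ n`, `μ`, such
that `π n → π` weakly. If `B n`, `B` are Borel subsets of `X` with `μ(B n △ B) → 0`,
then `1_{B n×Y}·π n` converge weakly to `1_{B×Y}·π`; in particular their `Y`-projections
converge weakly as well. -/
theorem restricted_plans_weakly_converge_varying
    {X Y : Type*} [MetricSpace X] [CompleteSpace X] [TopologicalSpace.SeparableSpace X]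
    [MetricSpace Y] [CompleteSpace Y]
    [MeasurableSpace X] [BorelSpace X] [MeasurableSpace Y] [BorelSpace Y]
    (μ : ℕ → Measure X) (μl : Measure X)
    (hμp : ∀ n, IsProbabilityMeasure (μ n)) (hμlp : IsProbabilityMeasure μl)
    (hμr : ∀ n, (μ n).InnerRegular) (hμlr : μl.InnerRegular)
    (hμtv : Tendsto (fun n => tvDist (μ n) μl) atTop (𝓝 0))
    (π : ℕ → Measure (X × Y)) (πl : Measure (X × Y))
    (hπp : ∀ n, IsProbabilityMeasure (π n)) (hπlp : IsProbabilityMeasure πl)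
    (hπr : ∀ n, (π n).InnerRegular) (hπlr : πl.InnerRegular)
    (hproj : ∀ n, (π n).map Prod.fst = μ n) (hprojl : πl.map Prod.fst = μl)
    (hconv : ∀ f : BoundedContinuousFunction (X × Y) ℝ,
      Tendsto (fun n => ∫ p, f p ∂(π n)) atTop (𝓝 (∫ p, f p ∂πl)))
    (B : ℕ → Set X) (Bl : Set X)
    (hB : ∀ n, MeasurableSet (B n)) (hBl : MeasurableSet Bl)
    (hBconv : Tendsto (fun n => μl (symmDiff (B n) Bl)) atTop (𝓝 0)) :
    (∀ f : BoundedContinuousFunction (X × Y) ℝ,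
      Tendsto (fun n => ∫ p, f p ∂((π n).restrict (B n ×ˢ Set.univ))) atTop
        (𝓝 (∫ p, f p ∂(πl.restrict (Bl ×ˢ Set.univ))))) ∧
    (∀ g : BoundedContinuousFunction Y ℝ,
      Tendsto (fun n => ∫ y, g y ∂(((π n).restrict (B n ×ˢ Set.univ)).map Prod.snd)) atTop
        (𝓝 (∫ y, g y ∂((πl.restrict (Bl ×ˢ Set.univ)).map Prod.snd)))) := by
  have main : ∀ f : BoundedContinuousFunction (X × Y) ℝ,
      Tendsto (fun n => ∫ p, f p ∂((π n).restrict (B n ×ˢ Set.univ))) atTop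
        (𝓝 (∫ p, f p ∂(πl.restrict (Bl ×ˢ Set.univ)))) := by
    intro f
    rw [Metric.tendsto_nhds]
    intro ε hε
    set η : ℝ := ε / (5 * (‖f‖ + 1)) with hη
    have hf0 := norm_nonneg f
    have hηp : 0 < η := by positivity
    have hηe : 5 * (‖f‖ + 1) * η = ε := by rw [hη]; field_simp
    have hη0 : ENNReal.ofReal η ≠ 0 := by simpa using hηp
    obtain ⟨g, D, hD, hDm, hg01, hg⟩ := aux_fun μl Bl hBl (ENNReal.ofReal η) hη0
    have hc := hconv (f * g.compContinuous ⟨Prod.fst, continuous_fst⟩)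
    rw [Metric.tendsto_nhds] at hc
    have hl := aux_ineq πl f g Bl D hBl hD hg
    rw [hprojl] at hl
    have hDr : μl.real D ≤ η := ENNReal.toReal_le_of_le_ofReal hηp.le hDm
    filter_upwards [hc η hηp, hμtv.eventually_lt_const (pos_iff_ne_zero.2 hη0),
      hBconv.eventually_lt_const (pos_iff_ne_zero.2 hη0)] with n h1 h2 h3
    have hDn : MeasurableSet (D ∪ symmDiff (B n) Bl) := hD.union ((hB n).symmDiff hBl)
    have hn := aux_ineq (π n) f g (B n) (D ∪ symmDiff (B n) Bl) (hB n) hDn (by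
      intro x
      by_cases hx : x ∈ symmDiff (B n) Bl
      · rw [Set.indicator_of_mem (Set.mem_union_right D hx)]
        have := hg01 x
        by_cases a : x ∈ B n <;> simp [Set.indicator, a, abs_le] <;>
          constructor <;> linarith [this.1, this.2]
      · have e : (B n).indicator (fun _ => (1 : ℝ)) x = Bl.indicator (fun _ => (1 : ℝ)) x := by
          rw [Set.mem_symmDiff] at hx
          by_cases a : x ∈ B n <;> by_cases b : x ∈ Bl <;> simp_all
        rw [e]
        refine (hg x).trans ?_
        exact Set.indicator_le_indicator_of_subset Set.subset_union_left (fun _ => zero_le_one) x)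
    rw [hproj] at hn
    have hm : (μ n) (D ∪ symmDiff (B n) Bl) ≤ ENNReal.ofReal (3 * η) := by
      have t : (μ n) (D ∪ symmDiff (B n) Bl) - μl (D ∪ symmDiff (B n) Bl) ≤ tvDist (μ n) μl :=
        le_self_add.trans (le_iSup₂_of_le (f := fun (s : Set X) (_ : MeasurableSet s) =>
          ((μ n) s - μl s) + (μl s - (μ n) s)) _ hDn le_rfl)
      rw [tsub_le_iff_right] at t
      calc _ ≤ _ := t
        _ ≤ ENNReal.ofReal η + (ENNReal.ofReal η + ENNReal.ofReal η) :=
          add_le_add h2.le ((measure_union_le _ _).trans (add_le_add hDm h3.le))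
        _ = _ := by
          rw [← ENNReal.ofReal_add hηp.le hηp.le, ← ENNReal.ofReal_add hηp.le (by positivity)]
          congr 1; ring
    have hmr : (μ n).real (D ∪ symmDiff (B n) Bl) ≤ 3 * η :=
      ENNReal.toReal_le_of_le_ofReal (by positivity) hm
    have a1 := mul_le_mul_of_nonneg_left hmr hf0
    have a2 := mul_le_mul_of_nonneg_left hDr hf0
    simp only [BoundedContinuousFunction.coe_mul, Pi.mul_apply,
      BoundedContinuousFunction.compContinuous_apply, ContinuousMap.coe_mk, Real.dist_eq] at h1
    rw [Real.dist_eq]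
    rw [abs_lt] at h1 ⊢
    rw [abs_le] at hl hn
    constructor <;> nlinarith [hl.1, hl.2, hn.1, hn.2, h1.1, h1.2]
  haveI : SecondCountableTopology X := UniformSpace.secondCountable_of_separable X
  refine ⟨main, fun g => ?_⟩
  have h := main (g.compContinuous ⟨Prod.snd, continuous_snd⟩)
  have e : ∀ ν : Measure (X × Y), ∫ y, g y ∂(ν.map Prod.snd) = ∫ p, g p.2 ∂ν := fun ν =>
    integral_map measurable_snd.aemeasurable g.continuous.aestronglyMeasurable
  simp only [e]
  exact h
end
end

section
/- Let X and Y be topological spaces, let μ and ν be Radon probability measures on X and Y respectively, and let h : X × Y → [0,1] be a Borel cost function. Let K₁ ⊂ X and K₂ ⊂ Y be Borel sets with μ(K₁) > 0, ν(K₂) > 0 and ν(Y ∖ K₂) ≤ μ(X ∖ K₁), and set α = μ(K₁)/ν(K₂) (so α ≤ 1). Then the Kantorovich cost between the restricted marginals satisfies K_h(μ|_{K₁}, α·ν|_{K₂}) ≤ K_h(μ, ν) + μ(X ∖ K₁), where K_h between two finite measures of equal total mass m is the infimum of ∫ h dσ over measures σ on X×Y with the given projections. -/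
open MeasureTheory Filter Topology

noncomputable section

/-- `σ` is a coupling of the (finite) measures `μ` and `ν`: a measure on the product
whose projections onto the factors are `μ` and `ν`. -/
def IsCoupling {X Y : Type*} [MeasurableSpace X] [MeasurableSpace Y]
    (σ : Measure (X × Y)) (μ : Measure X) (ν : Measure Y) : Prop :=
  σ.map Prod.fst = μ ∧ σ.map Prod.snd = ν

/-- The Kantorovich optimal transportation cost between two (finite) measures:
`K_h(μ, ν) = inf {∫ h dσ : σ` a measure on `X × Y` with projections `μ` and `ν}`. -/
def kantorovichCost {X Y : Type*} [MeasurableSpace X] [MeasurableSpace Y]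
    (h : X → Y → ℝ) (μ : Measure X) (ν : Measure Y) : ENNReal :=
  ⨅ (σ : Measure (X × Y)) (_ : IsCoupling σ μ ν), ∫⁻ p, ENNReal.ofReal (h p.1 p.2) ∂σ

lemma exists_fill {X Y : Type*} [MeasurableSpace X] [MeasurableSpace Y]
    (a : Measure X) (b : Measure Y) [IsFiniteMeasure a] [IsFiniteMeasure b]
    (hab : a Set.univ = b Set.univ) :
    ∃ τ : Measure (X × Y), IsCoupling τ a b := by
  by_cases h0 : b Set.univ = 0
  · have hb : b = 0 := Measure.measure_univ_eq_zero.1 h0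
    have ha : a = 0 := Measure.measure_univ_eq_zero.1 (hab.trans h0)
    exact ⟨0, by simp [IsCoupling, ha, hb]⟩
  · have ht : b Set.univ ≠ ⊤ := measure_ne_top _ _
    refine ⟨(b Set.univ)⁻¹ • a.prod b, ?_, ?_⟩
    · rw [Measure.map_smul, Measure.map_fst_prod, smul_smul, ENNReal.inv_mul_cancel h0 ht, one_smul]
    · rw [Measure.map_smul, Measure.map_snd_prod, smul_smul, hab, ENNReal.inv_mul_cancel h0 ht,
        one_smul]

/-- For Radon probability measures `μ`, `ν`, a Borel cost
`h : X × Y → [0,1]`, and Borel sets `K₁ ⊆ X`, `K₂ ⊆ Y` with `μ(K₁) > 0`, `ν(K₂) > 0`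
and `ν(Y ∖ K₂) ≤ μ(X ∖ K₁)`, setting `α = μ(K₁)/ν(K₂)`, the Kantorovich cost between
the restricted marginals satisfies
`K_h(μ|_{K₁}, α·ν|_{K₂}) ≤ K_h(μ, ν) + μ(X ∖ K₁)`. -/
theorem kantorovich_restricted_marginals_bound
    {X Y : Type*} [TopologicalSpace X] [TopologicalSpace Y]
    [MeasurableSpace X] [BorelSpace X] [MeasurableSpace Y] [BorelSpace Y]
    (μ : Measure X) (ν : Measure Y)
    (hμp : IsProbabilityMeasure μ) (hνp : IsProbabilityMeasure ν)
    (hμr : μ.InnerRegular) (hνr : ν.InnerRegular)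
    (h : X → Y → ℝ) (hmeas : Measurable fun p : X × Y => h p.1 p.2)
    (h0 : ∀ x y, 0 ≤ h x y) (h1 : ∀ x y, h x y ≤ 1)
    (K₁ : Set X) (K₂ : Set Y) (hK₁ : MeasurableSet K₁) (hK₂ : MeasurableSet K₂)
    (hμK₁ : 0 < μ K₁) (hνK₂ : 0 < ν K₂) (hmass : ν K₂ᶜ ≤ μ K₁ᶜ) :
    kantorovichCost h (μ.restrict K₁) ((μ K₁ / ν K₂) • ν.restrict K₂) ≤
      kantorovichCost h μ ν + μ K₁ᶜ := by
  set α : ENNReal := μ K₁ / ν K₂ with hα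
  have hle : μ K₁ ≤ ν K₂ := by
    have e1 := prob_compl_eq_one_sub (μ := μ) hK₁.compl
    have e2 := prob_compl_eq_one_sub (μ := ν) hK₂.compl
    rw [compl_compl] at e1 e2
    rw [e1, e2]
    exact tsub_le_tsub_left hmass 1
  have hα1 : α ≤ 1 := ENNReal.div_le_of_le_mul (by simpa using hle)
  have hαt : α ≠ ⊤ := ne_top_of_le_ne_top ENNReal.one_ne_top hα1
  have hαν : α * ν K₂ = μ K₁ := ENNReal.div_mul_cancel hνK₂.ne' (measure_ne_top _ _)
  have key : ∀ σ : Measure (X × Y), IsCoupling σ μ ν →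
      kantorovichCost h (μ.restrict K₁) (α • ν.restrict K₂) ≤
        ∫⁻ p, ENNReal.ofReal (h p.1 p.2) ∂σ + μ K₁ᶜ := by
    rintro σ ⟨hs1, hs2⟩
    have hσf : IsFiniteMeasure σ := ⟨by
      have : σ Set.univ = μ Set.univ := by
        rw [← hs1, Measure.map_apply measurable_fst MeasurableSet.univ, Set.preimage_univ]
      rw [this]; exact measure_lt_top _ _⟩
    set σ₀ : Measure (X × Y) := α • σ.restrict (K₁ ×ˢ K₂) with hσ₀
    have f1 : σ₀.map Prod.fst ≤ μ.restrict K₁ := by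
      refine Measure.le_iff.2 fun s hs => ?_
      rw [Measure.map_apply measurable_fst hs, Measure.restrict_apply hs, hσ₀,
        Measure.smul_apply, smul_eq_mul, Measure.restrict_apply (measurable_fst hs), ← hs1,
        Measure.map_apply measurable_fst (hs.inter hK₁)]
      refine (mul_le_of_le_one_left zero_le hα1).trans (measure_mono ?_)
      rintro p ⟨hp, hq⟩
      exact ⟨hp, hq.1⟩
    let b : Measure Y := α • (σ.restrict (K₁ᶜ ×ˢ K₂)).map Prod.snd
    have f2 : b + σ₀.map Prod.snd = α • ν.restrict K₂ := by
      refine Measure.ext fun s hs => ?_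
      simp only [b, hσ₀, Measure.map_smul, Measure.add_apply, Measure.smul_apply, smul_eq_mul]
      rw [← mul_add, Measure.map_apply measurable_snd hs, Measure.map_apply measurable_snd hs,
        Measure.restrict_apply hs, Measure.restrict_apply (measurable_snd hs),
        Measure.restrict_apply (measurable_snd hs), ← hs2,
        Measure.map_apply measurable_snd (hs.inter hK₂),
        ← measure_inter_add_diff (Prod.snd ⁻¹' (s ∩ K₂)) (measurable_fst hK₁.compl)]
      congr 3
      · ext p; simp; tauto
      · ext p; simp; tauto
    have hσ₀f : IsFiniteMeasure σ₀ := Measure.smul_finite _ hαt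
    have hbf : IsFiniteMeasure b := Measure.smul_finite _ hαt
    let a : Measure X := μ.restrict K₁ - σ₀.map Prod.fst
    have f1' : a + σ₀.map Prod.fst = μ.restrict K₁ := Measure.sub_add_cancel_of_le f1
    have hab : a Set.univ = b Set.univ := by
      have e1 := congrArg (fun m => m Set.univ) f1'
      have e2 := congrArg (fun m => m Set.univ) f2
      simp only [Measure.add_apply, Measure.smul_apply, smul_eq_mul, Measure.restrict_apply_univ,
        hαν, Measure.map_apply measurable_fst MeasurableSet.univ,
        Measure.map_apply measurable_snd MeasurableSet.univ, Set.preimage_univ] at e1 e2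
      exact (ENNReal.add_left_inj (measure_ne_top σ₀ Set.univ)).1 (e1.trans e2.symm)
    obtain ⟨τ, ht1, ht2⟩ := exists_fill a b hab
    have hc : IsCoupling (τ + σ₀) (μ.restrict K₁) (α • ν.restrict K₂) :=
      ⟨by rw [Measure.map_add _ _ measurable_fst, ht1, f1'],
       by rw [Measure.map_add _ _ measurable_snd, ht2, f2]⟩
    refine (iInf₂_le (τ + σ₀) hc).trans ?_
    rw [lintegral_add_measure, add_comm]
    refine add_le_add ?_ ?_
    · rw [hσ₀, lintegral_smul_measure, smul_eq_mul]
      exact (mul_le_of_le_one_left zero_le hα1).trans (setLIntegral_le_lintegral _ _)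
    · calc ∫⁻ p, ENNReal.ofReal (h p.1 p.2) ∂τ ≤ ∫⁻ _, 1 ∂τ :=
            lintegral_mono fun p => by simpa using h1 p.1 p.2
        _ = b Set.univ := by
            rw [lintegral_one, ← ht2, Measure.map_apply measurable_snd MeasurableSet.univ,
              Set.preimage_univ]
        _ ≤ σ (K₁ᶜ ×ˢ K₂) := by
            simp only [b, Measure.smul_apply, smul_eq_mul,
              Measure.map_apply measurable_snd MeasurableSet.univ, Set.preimage_univ,
              Measure.restrict_apply_univ]
            exact mul_le_of_le_one_left zero_le hα1
        _ ≤ μ K₁ᶜ := by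
            rw [← hs1, Measure.map_apply measurable_fst hK₁.compl]
            exact measure_mono fun p hp => hp.1
  conv_rhs => rw [kantorovichCost]
  simp only [ENNReal.iInf_add]
  exact le_iInf₂ key
end
end

section
/- Let X̃ be a complete separable metric space, X a Hausdorff topological space, f : X̃ → X a continuous surjection, and g : X → X̃ a Borel-measurable mapping with f(g(x)) = x for all x ∈ X. Let μ be a Radon probability measure on X, set γ = μ∘g⁻¹, let Y be a topological space, ν a Radon probability measure on Y, and h : X × Y → [0,∞) a Borel function. Then the Kantorovich cost for the cost function h̃(x̃, y) = h(f(x̃), y) with marginals (γ, ν) equals the Kantorovich cost for h with marginals (μ, ν): K_{h̃}(γ, ν) = K_h(μ, ν). -/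
open MeasureTheory Filter Topology

noncomputable section

theorem isCoupling_map_aux {A B Y : Type*} [MeasurableSpace A] [MeasurableSpace B]
    [MeasurableSpace Y] {u : A → B} (hu : Measurable u) (α : Measure A) {ν : Measure Y}
    (σ : Measure (A × Y)) (hσ : IsCoupling σ α ν) :
    IsCoupling (σ.map (Prod.map u id)) (α.map u) ν := by
  have hm : Measurable (Prod.map u (id : Y → Y)) := hu.prodMap measurable_id
  refine ⟨?_, ?_⟩
  · rw [← hσ.1, Measure.map_map measurable_fst hm, Measure.map_map hu measurable_fst]
    rfl
  · rw [Measure.map_map measurable_snd hm]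
    exact hσ.2

/-- Let `X̃` be a complete separable metric space, `X` Hausdorff,
`f : X̃ → X` a continuous surjection, `g : X → X̃` Borel-measurable with `f ∘ g = id`.
For a Radon probability measure `μ` on `X`, `γ = μ ∘ g⁻¹`, a Radon probability measure
`ν` on a topological space `Y`, and a nonnegative Borel cost `h`, the Kantorovich cost
for the lifted cost `h̃(x̃, y) = h(f(x̃), y)` with marginals `(γ, ν)` equals the
Kantorovich cost for `h` with marginals `(μ, ν)`. -/
theorem kantorovich_cost_lifted
    {Xt X Y : Type*} [MetricSpace Xt] [CompleteSpace Xt] [TopologicalSpace.SeparableSpace Xt]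
    [TopologicalSpace X] [T2Space X] [TopologicalSpace Y]
    [MeasurableSpace Xt] [BorelSpace Xt] [MeasurableSpace X] [BorelSpace X]
    [MeasurableSpace Y] [BorelSpace Y]
    (f : Xt → X) (hf : Continuous f) (hfsurj : Function.Surjective f)
    (g : X → Xt) (hg : Measurable g) (hfg : ∀ x, f (g x) = x)
    (μ : Measure X) (hμp : IsProbabilityMeasure μ) (hμr : μ.InnerRegular)
    (ν : Measure Y) (hνp : IsProbabilityMeasure ν) (hνr : ν.InnerRegular)
    (h : X → Y → ℝ) (hmeas : Measurable fun p : X × Y => h p.1 p.2)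
    (hnonneg : ∀ x y, 0 ≤ h x y) :
    kantorovichCost (fun xt y => h (f xt) y) (μ.map g) ν = kantorovichCost h μ ν := by
  have hfm : Measurable f := hf.measurable
  have hmf : Measurable (Prod.map f (id : Y → Y)) := hfm.prodMap measurable_id
  have hmg : Measurable (Prod.map g (id : Y → Y)) := hg.prodMap measurable_id
  have hc : Measurable fun p : X × Y => ENNReal.ofReal (h p.1 p.2) := hmeas.ennreal_ofReal
  have hid : (μ.map g).map f = μ := by
    rw [Measure.map_map hfm hg]
    have : f ∘ g = id := funext hfg
    rw [this, Measure.map_id]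
  unfold kantorovichCost
  apply le_antisymm
  · refine le_iInf₂ fun σ hσ => ?_
    refine (iInf₂_le (σ.map (Prod.map g id)) (isCoupling_map_aux hg μ σ hσ)).trans (le_of_eq ?_)
    have hc' : Measurable fun p : Xt × Y => ENNReal.ofReal (h (f p.1) p.2) := hc.comp hmf
    rw [lintegral_map hc' hmg]
    simp [hfg]
  · refine le_iInf₂ fun σ hσ => ?_
    have h1 := isCoupling_map_aux hfm _ σ hσ
    rw [hid] at h1
    refine (iInf₂_le (σ.map (Prod.map f id)) h1).trans (le_of_eq ?_)
    rw [lintegral_map hc hmf]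
    rfl
end
end
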